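/- Given an NBW A = (Σ, Q, q₀, δ, F), the improved slice-based construction produces an NBW A' = (Σ, S, s₀, Δ, G) — with states the (un)decorated slices over Q, s₀ = the slice ({q₀}), accepting states the decorated reset slices, and transitions: from an undecorated slice s on a, go to δ_u(s,a) and additionally to merge(δ_g'(s,a)) if δ_g'(s,a) is not doomed; from a decorated slice s, go to merge(δ_d'(s,a)) provided it is not doomed — such that L(A') equals the complement Σ^ω − L(A). -/

import Mathlib

/-- A nondeterministic Büchi automaton. -/
structure NBW (A Q : Type*) where
  init : Q
  trans : Q → A → Set Q
  acc : Set Q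

def NBW.IsRun {A Q : Type*} (M : NBW A Q) (w : ℕ → A) (ρ : ℕ → Q) : Prop :=
  ρ 0 = M.init ∧ ∀ i, ρ (i + 1) ∈ M.trans (ρ i) (w i)

def NBW.Accepting {A Q : Type*} (M : NBW A Q) (ρ : ℕ → Q) : Prop :=
  ∃ q ∈ M.acc, ∀ N, ∃ i ≥ N, ρ i = q

def NBW.Lang {A Q : Type*} (M : NBW A Q) : Set (ℕ → A) :=
  {w | ∃ ρ, M.IsRun w ρ ∧ M.Accepting ρ}


/-- Decorations of slice nodes. -/
inductive Dec | zero | star | one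
deriving DecidableEq

/-- A decorated slice: a sequence of sets of states with decorations. -/
abbrev DSlice (Q : Type*) := List (Set Q × Dec)

/-- Two adjacent decorations are mergible iff equal and in `{0, *}`. -/
def mergibleB (d e : Dec) : Bool :=
  decide (d = e) && (decide (d = Dec.zero) || decide (d = Dec.star))

/-- `merge`: recursively merge all adjacent mergible nodes. -/
def dmerge {Q : Type*} : DSlice Q → DSlice Q
  | [] => []
  | [x] => [x]
  | x :: y :: rest =>
    if mergibleB x.2 y.2 then dmerge ((x.1 ∪ y.1, x.2) :: rest)
    else x :: dmerge (y :: rest)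
termination_by s => s.length

/-- Merge as many as possible but at most `j` merging operations at the front
(so at most `j + 1` consecutive nodes get merged into one). -/
def mergeFront {Q : Type*} : ℕ → DSlice Q → DSlice Q
  | 0, s => s
  | _ + 1, [] => []
  | _ + 1, [x] => [x]
  | j + 1, x :: y :: rest =>
    if mergibleB x.2 y.2 then mergeFront j ((x.1 ∪ y.1, x.2) :: rest) else x :: y :: rest

/-- The positions of the mergible pairs of adjacent nodes, left to right. -/
def mergiblePos {Q : Type*} (s : DSlice Q) : List ℕ :=
  (List.range s.length).filter fun k =>
    match s[k]?, s[k + 1]? with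
    | some x, some y => mergibleB x.2 y.2
    | _, _ => false

/-- `merge_{i,j}`: merge as many as possible and at most `j` consecutive
mergible nodes, starting from the `i`-th (1-indexed) mergible pair. -/
def mergeIJ {Q : Type*} (i j : ℕ) (s : DSlice Q) : DSlice Q :=
  match (mergiblePos s)[i - 1]? with
  | none => s
  | some k => s.take k ++ mergeFront (j - 1) (s.drop k)

/-- A (decorated) slice is a reset slice iff no node is decorated `0`. -/
def isResetB {Q : Type*} (s : DSlice Q) : Bool := s.all fun x => !(decide (x.2 = Dec.zero))

/-- A slice is doomed iff no node is decorated `1`. -/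
def Doomed {Q : Type*} (s : DSlice Q) : Prop := ∀ x ∈ s, x.2 ≠ Dec.one

/-- Decorations of the (left, right) children of a `d`-decorated node,
depending on whether the current slice is a reset slice. -/
def decPair (reset : Bool) (d : Dec) : Dec × Dec :=
  if reset then
    match d with
    | Dec.one => (Dec.zero, Dec.one)
    | _ => (Dec.zero, Dec.zero)
  else
    match d with
    | Dec.one => (Dec.star, Dec.one)
    | d => (d, d)

/-- One step of decorated-slice evolution, before deletion of empty nodes. -/
def ddAux {A Q : Type*} (δ : Q → A → Set Q) (F : Set Q) (a : A) (reset : Bool) :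
    DSlice Q → Set Q → DSlice Q
  | [], _ => []
  | (Qi, d) :: rest, seen =>
    ((((⋃ q ∈ Qi, δ q a) ∩ F) \ seen), (decPair reset d).1) ::
    ((((⋃ q ∈ Qi, δ q a) \ F) \ seen), (decPair reset d).2) ::
      ddAux δ F a reset rest
        (seen ∪ ((((⋃ q ∈ Qi, δ q a) ∩ F) \ seen)) ∪ (((⋃ q ∈ Qi, δ q a) \ F) \ seen))

/-- The deterministic decorated-successor function `δ_d'` of the improved
slice-based construction: split nodes, decorate children, delete empty nodes. -/
noncomputable def ddSucc {A Q : Type*} (δ : Q → A → Set Q) (F : Set Q)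
    (s : DSlice Q) (a : A) : DSlice Q :=
  (ddAux δ F a (isResetB s) s ∅).filter fun x => @decide x.1.Nonempty (Classical.propDecidable _)

/-- One step of undecorated-slice evolution, before deletion of empty nodes. -/
def duAux {A Q : Type*} (δ : Q → A → Set Q) (F : Set Q) (a : A) :
    List (Set Q) → Set Q → List (Set Q)
  | [], _ => []
  | Qi :: rest, seen =>
    ((((⋃ q ∈ Qi, δ q a) ∩ F) \ seen)) :: (((⋃ q ∈ Qi, δ q a) \ F) \ seen) ::
      duAux δ F a rest
        (seen ∪ ((((⋃ q ∈ Qi, δ q a) ∩ F) \ seen)) ∪ (((⋃ q ∈ Qi, δ q a) \ F) \ seen))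

/-- The undecorated-slice evolution `δ_u`: split nodes and delete empty nodes. -/
noncomputable def duSucc {A Q : Type*} (δ : Q → A → Set Q) (F : Set Q)
    (s : List (Set Q)) (a : A) : List (Set Q) :=
  (duAux δ F a s ∅).filter fun S => @decide S.Nonempty (Classical.propDecidable _)

/-- One step of the guessing transition, before deletion of empty nodes:
left (accepting) children are decorated `0`, right children `1`. -/
def dgAux {A Q : Type*} (δ : Q → A → Set Q) (F : Set Q) (a : A) :
    List (Set Q) → Set Q → DSlice Q
  | [], _ => []
  | Qi :: rest, seen =>
    ((((⋃ q ∈ Qi, δ q a) ∩ F) \ seen), Dec.zero) ::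
    ((((⋃ q ∈ Qi, δ q a) \ F) \ seen), Dec.one) ::
      dgAux δ F a rest
        (seen ∪ ((((⋃ q ∈ Qi, δ q a) ∩ F) \ seen)) ∪ (((⋃ q ∈ Qi, δ q a) \ F) \ seen))

/-- The deterministic guessing function `δ_g'` of the improved construction. -/
noncomputable def dgSucc {A Q : Type*} (δ : Q → A → Set Q) (F : Set Q)
    (s : List (Set Q)) (a : A) : DSlice Q :=
  (dgAux δ F a s ∅).filter fun x => @decide x.1.Nonempty (Classical.propDecidable _)

/-- The improved slice-based complement of an NBW. States are undecorated
slices (`Sum.inl`) and decorated slices (`Sum.inr`); the empty slice `⊥` is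
represented as the decorated `Sum.inr []`. Accepting states are the decorated
reset slices. -/
noncomputable def sliceComplement {A Q : Type*} (M : NBW A Q) :
    NBW A (List (Set Q) ⊕ DSlice Q) where
  init := Sum.inl [{M.init}]
  trans := fun s a =>
    match s with
    | Sum.inl u =>
      {t | t = (match duSucc M.trans M.acc u a with
                | [] => Sum.inr ([] : DSlice Q)
                | l => Sum.inl l)} ∪
      {t | ¬ Doomed (dgSucc M.trans M.acc u a) ∧
           t = Sum.inr (dmerge (dgSucc M.trans M.acc u a))}
    | Sum.inr d =>
      match d with
      | [] => {Sum.inr ([] : DSlice Q)}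
      | d => {t | ¬ Doomed (ddSucc M.trans M.acc d a) ∧
                  t = Sum.inr (dmerge (ddSucc M.trans M.acc d a))}
  acc := {s | ∃ d : DSlice Q, s = Sum.inr d ∧ ∀ x ∈ d, x.2 ≠ Dec.zero}

instance : Finite Dec :=
  Finite.of_injective (fun d : Dec => match d with
    | Dec.zero => (0 : Fin 3)
    | Dec.star => 1
    | Dec.one => 2) (by intro a b; cases a <;> cases b <;> simp)

section Merge

variable {A Q : Type*}

/-- Prepend a node to a merged slice, merging it with the first node if possible. -/
def mergeCons (x : Set Q × Dec) : DSlice Q → DSlice Q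
  | [] => [x]
  | y :: l => if mergibleB x.2 y.2 then (x.1 ∪ y.1, x.2) :: l else x :: y :: l

theorem mergibleB_iff (d e : Dec) : mergibleB d e = true ↔ d = e ∧ d ≠ Dec.one := by
  cases d <;> cases e <;> simp [mergibleB]

theorem mergeCons_mergeCons {x y : Set Q × Dec} (h : mergibleB x.2 y.2) (l : DSlice Q) :
    mergeCons x (mergeCons y l) = mergeCons (x.1 ∪ y.1, x.2) l := by
  have h' := (mergibleB_iff _ _).1 h
  cases l with
  | nil => simp [mergeCons, h]
  | cons z l =>
    by_cases hz : mergibleB y.2 z.2 <;>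
      simp [mergeCons, hz, h'.1, h'.1 ▸ h, Set.union_assoc]

theorem mergeCons_of_not_mergible {x y : Set Q × Dec} (h : ¬ mergibleB x.2 y.2) (l : DSlice Q) :
    mergeCons x (mergeCons y l) = x :: mergeCons y l := by
  cases l with
  | nil => simp [mergeCons, h]
  | cons z l => by_cases hz : mergibleB y.2 z.2 <;> simp [mergeCons, h, hz]

theorem dmerge_cons (x : Set Q × Dec) (s : DSlice Q) :
    dmerge (x :: s) = mergeCons x (dmerge s) := by
  induction hn : s.length using Nat.strong_induction_on generalizing x s with
  | _ n ih =>
    cases s with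
    | nil => simp [dmerge, mergeCons]
    | cons y l =>
      have hl : l.length < n := by rw [← hn]; simp
      rw [ih _ hl y l rfl, dmerge]
      by_cases h : mergibleB x.2 y.2
      · rw [if_pos h, ih _ hl _ l rfl, mergeCons_mergeCons h]
      · rw [if_neg h, mergeCons_of_not_mergible h, ih _ hl y l rfl]

theorem length_dmerge_le (s : DSlice Q) : (dmerge s).length ≤ s.length := by
  induction s with
  | nil => simp [dmerge]
  | cons x s ih =>
    rw [dmerge_cons]
    cases h : dmerge s with
    | nil => simp [mergeCons]
    | cons y l =>
      rw [h] at ih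
      simp only [mergeCons, List.length_cons] at ih ⊢
      split_ifs <;> simp <;> omega

theorem exists_mem_dmerge_iff (e : Dec) (s : DSlice Q) :
    (∃ x ∈ dmerge s, x.2 = e) ↔ ∃ x ∈ s, x.2 = e := by
  induction s with
  | nil => simp [dmerge]
  | cons x s ih =>
    rw [dmerge_cons, List.exists_mem_cons_iff, ← ih]
    cases h : dmerge s with
    | nil => simp [mergeCons]
    | cons y l =>
      by_cases hm : mergibleB x.2 y.2
      · have := ((mergibleB_iff _ _).1 hm).1
        rw [mergeCons, if_pos hm]
        simp only [List.exists_mem_cons_iff, this]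
        tauto
      · simp [mergeCons, hm]

theorem forall_mem_dmerge_ne_iff (e : Dec) (s : DSlice Q) :
    (∀ x ∈ dmerge s, x.2 ≠ e) ↔ ∀ x ∈ s, x.2 ≠ e := by
  simpa only [not_exists, not_and] using not_congr (exists_mem_dmerge_iff e s)

theorem dmerge_eq_nil_iff (s : DSlice Q) : dmerge s = [] ↔ s = [] := by
  cases s with
  | nil => simp [dmerge]
  | cons x s =>
    rw [dmerge_cons]
    cases dmerge s with
    | nil => simp [mergeCons]
    | cons y l => simp only [mergeCons]; split_ifs <;> simp

theorem isResetB_iff (s : DSlice Q) : isResetB s = true ↔ ∀ x ∈ s, x.2 ≠ Dec.zero := by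
  simp [isResetB]

theorem isResetB_dmerge (s : DSlice Q) : isResetB (dmerge s) = isResetB s := by
  rw [Bool.eq_iff_iff, isResetB_iff, isResetB_iff, forall_mem_dmerge_ne_iff]

/-- Delete the empty nodes of a decorated slice, then merge. -/
noncomputable def cleanMerge (s : DSlice Q) : DSlice Q :=
  dmerge (s.filter fun x => @decide x.1.Nonempty (Classical.propDecidable _))

theorem cleanMerge_cons_of_empty {x : Set Q × Dec} (h : ¬ x.1.Nonempty) (s : DSlice Q) :
    cleanMerge (x :: s) = cleanMerge s := by
  simp [cleanMerge, h]

theorem cleanMerge_cons_of_nonempty {x : Set Q × Dec} (h : x.1.Nonempty) (s : DSlice Q) :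
    cleanMerge (x :: s) = mergeCons x (cleanMerge s) := by
  simp [cleanMerge, h, dmerge_cons]

theorem cleanMerge_cons_congr (x : Set Q × Dec) {s t : DSlice Q}
    (h : cleanMerge s = cleanMerge t) : cleanMerge (x :: s) = cleanMerge (x :: t) := by
  by_cases hx : x.1.Nonempty
  · rw [cleanMerge_cons_of_nonempty hx, cleanMerge_cons_of_nonempty hx, h]
  · rw [cleanMerge_cons_of_empty hx, cleanMerge_cons_of_empty hx, h]

theorem cleanMerge_cons_cons {e : Dec} (he : e ≠ Dec.one) (S T : Set Q) (s : DSlice Q) :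
    cleanMerge ((S, e) :: (T, e) :: s) = cleanMerge ((S ∪ T, e) :: s) := by
  by_cases hS : S.Nonempty
  · have hST : (S ∪ T).Nonempty := hS.mono Set.subset_union_left
    by_cases hT : T.Nonempty
    · rw [cleanMerge_cons_of_nonempty hS, cleanMerge_cons_of_nonempty hT,
        cleanMerge_cons_of_nonempty hST, mergeCons_mergeCons]
      exact (mergibleB_iff _ _).2 ⟨rfl, he⟩
    · obtain rfl := Set.not_nonempty_iff_eq_empty.1 hT
      refine cleanMerge_cons_congr _ (cleanMerge_cons_of_empty hT s) |>.trans ?_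
      rw [Set.union_empty]
  · obtain rfl := Set.not_nonempty_iff_eq_empty.1 hS
    rw [cleanMerge_cons_of_empty hS, Set.empty_union]

theorem exists_decPair_eq {d : Dec} (hd : d ≠ Dec.one) (r : Bool) :
    ∃ e, e ≠ Dec.one ∧ decPair r d = (e, e) := by
  cases r <;> cases d <;> simp_all [decPair]

theorem cleanMerge_ddAux_dmerge (δ : Q → A → Set Q) (F : Set Q) (a : A) (r : Bool)
    (s : DSlice Q) (seen : Set Q) :
    cleanMerge (ddAux δ F a r (dmerge s) seen) = cleanMerge (ddAux δ F a r s seen) := by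
  induction hn : s.length using Nat.strong_induction_on generalizing s seen with
  | _ n ih =>
    match s, hn with
    | [], _ => simp [dmerge]
    | [x], _ => simp [dmerge]
    | (X, d) :: (Y, e) :: l, hn =>
      rw [dmerge]
      by_cases h : mergibleB d e
      · rw [if_pos h, ih (l.length + 1) (by simp [← hn]) _ _ (by simp)]
        obtain ⟨rfl, hd⟩ := (mergibleB_iff _ _).1 h
        obtain ⟨c, hc, hp⟩ := exists_decPair_eq hd r
        simp only [ddAux, hp]
        rw [cleanMerge_cons_cons hc, cleanMerge_cons_cons hc, cleanMerge_cons_cons hc,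
          cleanMerge_cons_cons hc]
        rw [Set.biUnion_union]
        generalize (⋃ q ∈ X, δ q a) = P
        generalize (⋃ q ∈ Y, δ q a) = R
        congr 2
        · congr 1
          ext q
          by_cases q ∈ P <;> by_cases q ∈ R <;> by_cases q ∈ F <;> by_cases q ∈ seen <;> simp [*]
        · congr 1
          ext q
          by_cases q ∈ P <;> by_cases q ∈ R <;> by_cases q ∈ F <;> by_cases q ∈ seen <;> simp [*]
      · rw [if_neg h]
        simp only [ddAux]
        refine cleanMerge_cons_congr _ (cleanMerge_cons_congr _ ?_)
        exact ih (l.length + 1) (by simp [← hn]) ((Y, e) :: l) _ (by simp)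

theorem dmerge_ddSucc_dmerge (δ : Q → A → Set Q) (F : Set Q) (s : DSlice Q) (a : A) :
    dmerge (ddSucc δ F (dmerge s) a) = dmerge (ddSucc δ F s a) := by
  have := cleanMerge_ddAux_dmerge δ F a (isResetB s) s ∅
  simpa only [ddSucc, isResetB_dmerge, cleanMerge] using this

theorem doomed_ddSucc_dmerge_iff (δ : Q → A → Set Q) (F : Set Q) (s : DSlice Q) (a : A) :
    Doomed (ddSucc δ F (dmerge s) a) ↔ Doomed (ddSucc δ F s a) := by
  unfold Doomed
  rw [← forall_mem_dmerge_ne_iff, dmerge_ddSucc_dmerge, forall_mem_dmerge_ne_iff]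

theorem dgAux_eq_ddAux (δ : Q → A → Set Q) (F : Set Q) (a : A) (u : List (Set Q))
    (seen : Set Q) :
    dgAux δ F a u seen = ddAux δ F a true (u.map fun S => (S, Dec.one)) seen := by
  induction u generalizing seen with
  | nil => rfl
  | cons S u ih => simp [dgAux, ddAux, ih, decPair]

theorem map_fst_ddAux (δ : Q → A → Set Q) (F : Set Q) (a : A) (r : Bool) (s : DSlice Q)
    (seen : Set Q) :
    (ddAux δ F a r s seen).map Prod.fst = duAux δ F a (s.map Prod.fst) seen := by
  induction s generalizing seen with
  | nil => rfl
  | cons x s ih => simp [duAux, ddAux, ih]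

theorem dgSucc_eq_ddSucc (δ : Q → A → Set Q) (F : Set Q) (u : List (Set Q)) (a : A) :
    dgSucc δ F u a = ddSucc δ F (u.map fun S => (S, Dec.one)) a := by
  have : isResetB (u.map fun S => (S, Dec.one)) = true := by
    rw [isResetB_iff]; simp
  rw [dgSucc, ddSucc, dgAux_eq_ddAux, this]

theorem map_fst_ddSucc (δ : Q → A → Set Q) (F : Set Q) (s : DSlice Q) (a : A) :
    (ddSucc δ F s a).map Prod.fst = duSucc δ F (s.map Prod.fst) a := by
  rw [ddSucc, duSucc, ← map_fst_ddAux δ F a (isResetB s), List.filter_map]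
  rfl

end Merge

/-- An inverse sequence of finite nonempty types has a coherent section. -/
theorem exists_coherent_section (X : ℕ → Type*) [∀ i, Finite (X i)] [∀ i, Nonempty (X i)]
    (f : ∀ i, X (i + 1) → X i) : ∃ x : ∀ i, X i, ∀ i, f i (x (i + 1)) = x i := by
  let F : CategoryTheory.Functor (Opposite ℕ) (Type _) := CategoryTheory.Functor.ofOpSequence (X := fun i => X i) fun i => TypeCat.ofHom (f i)
  have : ∀ j, Finite (F.obj j) := fun j => inferInstanceAs (Finite (X j.unop))
  have : ∀ j, Nonempty (F.obj j) := fun j => inferInstanceAs (Nonempty (X j.unop))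
  obtain ⟨s, hs⟩ := nonempty_sections_of_finite_cofiltered_system F
  refine ⟨fun i => s (Opposite.op i), fun i => ?_⟩
  have h := hs (CategoryTheory.homOfLE (Nat.le_succ i)).op
  rw [CategoryTheory.Functor.ofOpSequence_map_homOfLE_succ] at h
  exact h

/-- Kőnig's lemma for a relation between consecutive finite nonempty levels. -/
theorem exists_seq_of_forall_exists_pred {X : Type*} (S : ℕ → Set X) (hfin : ∀ i, (S i).Finite)
    (hne : ∀ i, (S i).Nonempty) (rel : ℕ → X → X → Prop)
    (hpred : ∀ i, ∀ y ∈ S (i + 1), ∃ x ∈ S i, rel i x y) :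
    ∃ x : ℕ → X, ∀ i, x i ∈ S i ∧ rel i (x i) (x (i + 1)) := by
  have : ∀ i, Finite (S i) := fun i => (hfin i).to_subtype
  have : ∀ i, Nonempty (S i) := fun i => (hne i).to_subtype
  choose! g hg using hpred
  obtain ⟨x, hx⟩ := exists_coherent_section (fun i => S i)
    fun i y => ⟨g i y, (hg i y y.2).1⟩
  refine ⟨fun i => x i, fun i => ⟨(x i).2, ?_⟩⟩
  have := (hg i (x (i + 1)) (x (i + 1)).2).2
  rwa [show g i (x (i + 1)) = x i from congrArg Subtype.val (hx i)] at this

namespace NBW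

variable {A Q : Type*} (M : NBW A Q) (w : ℕ → A)

/-- The states reachable after reading `i` letters of `w`. -/
def reach : ℕ → Set Q
  | 0 => {M.init}
  | i + 1 => ⋃ p ∈ reach i, M.trans p (w i)

/-- The position, on level `i` of the reduced split tree, of the node containing a state: the
binary digits record the path from the root, `0` for left children and `1` for right children. -/
noncomputable def key : ℕ → Q → ℕ
  | 0, _ => 0
  | i + 1, q => 2 * sInf {k | ∃ p ∈ M.reach w i, q ∈ M.trans p (w i) ∧ key i p = k} +
      @ite ℕ (q ∈ M.acc) (Classical.propDecidable _) 0 1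

/-- The node at position `k` on level `i` of the reduced split tree. -/
def node (i k : ℕ) : Set Q := {q | q ∈ M.reach w i ∧ M.key w i q = k}

variable {M w}

theorem mem_reach_succ {i : ℕ} {q : Q} :
    q ∈ M.reach w (i + 1) ↔ ∃ p ∈ M.reach w i, q ∈ M.trans p (w i) := by
  simp [reach]

theorem key_succ_div {i : ℕ} {q : Q} : M.key w (i + 1) q / 2 =
    sInf {k | ∃ p ∈ M.reach w i, q ∈ M.trans p (w i) ∧ M.key w i p = k} := by
  rw [key]; split_ifs <;> omega

theorem key_succ_mod {i : ℕ} {q : Q} : M.key w (i + 1) q % 2 = 0 ↔ q ∈ M.acc := by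
  rw [key]; split_ifs <;> simp_all

theorem exists_parent {i : ℕ} {q : Q} (hq : q ∈ M.reach w (i + 1)) :
    ∃ p ∈ M.reach w i, q ∈ M.trans p (w i) ∧ M.key w i p = M.key w (i + 1) q / 2 := by
  obtain ⟨p, hp, hpq⟩ := mem_reach_succ.1 hq
  rw [key_succ_div]
  exact Nat.sInf_mem (s := {k | ∃ p ∈ M.reach w i, q ∈ M.trans p (w i) ∧ M.key w i p = k})
    ⟨_, p, hp, hpq, rfl⟩

theorem key_succ_div_le {i : ℕ} {p q : Q} (hp : p ∈ M.reach w i) (hq : q ∈ M.trans p (w i)) :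
    M.key w (i + 1) q / 2 ≤ M.key w i p := by
  rw [key_succ_div]
  exact Nat.sInf_le ⟨p, hp, hq, rfl⟩

theorem node_nonempty_div {i k : ℕ} (h : (M.node w (i + 1) k).Nonempty) :
    (M.node w i (k / 2)).Nonempty := by
  obtain ⟨q, hq, rfl⟩ := h
  obtain ⟨p, hp, -, h⟩ := exists_parent hq
  exact ⟨p, hp, h⟩

theorem node_nonempty_div_pow {i j k : ℕ} (h : (M.node w (i + j) k).Nonempty) :
    (M.node w i (k / 2 ^ j)).Nonempty := by
  induction j generalizing k with
  | zero => simpa using h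
  | succ j ih =>
    rw [pow_succ', ← Nat.div_div_eq_div_mul]
    exact ih (node_nonempty_div h)

theorem finite_nonempty_node [Finite Q] (i : ℕ) : {k | (M.node w i k).Nonempty}.Finite := by
  refine (Set.finite_range (M.key w i)).subset ?_
  rintro k ⟨q, -, h⟩
  exact ⟨q, h⟩

variable (M w) in
/-- The infinite branches of the reduced split tree, as sequences of positions. -/
def IsBranch (β : ℕ → ℕ) : Prop :=
  ∀ i, (M.node w i (β i)).Nonempty ∧ β i = β (i + 1) / 2

theorem exists_branch_of_levels [Finite Q] (S : ℕ → Set ℕ) (hne : ∀ i, (S i).Nonempty)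
    (hS : ∀ i, ∀ k ∈ S i, (M.node w i k).Nonempty)
    (hpred : ∀ i, ∀ k ∈ S (i + 1), k / 2 ∈ S i) : ∃ β, M.IsBranch w β ∧ ∀ i, β i ∈ S i := by
  obtain ⟨β, hβ⟩ := exists_seq_of_forall_exists_pred S
    (fun i => (finite_nonempty_node (M := M) (w := w) i).subset (hS i)) hne
    (fun _ k l => k = l / 2) fun i l hl => ⟨l / 2, hpred i l hl, rfl⟩
  exact ⟨β, fun i => ⟨hS i _ (hβ i).1, (hβ i).2⟩, fun i => (hβ i).1⟩

theorem accepting_of_frequently_mem {ρ : ℕ → Q} {S : Set Q} (hfin : S.Finite)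
    (hS : S ⊆ M.acc) (h : ∀ n, ∃ i ≥ n, ρ i ∈ S) : M.Accepting ρ := by
  by_contra hacc
  have hrare : ∀ q ∈ S, ∀ᶠ i in Filter.atTop, ρ i ≠ q := by
    intro q hq
    by_contra h
    rw [Filter.not_eventually, Filter.frequently_atTop] at h
    exact hacc ⟨q, hS hq, fun n => by simpa using h n⟩
  obtain ⟨i, hi, h'⟩ :=
    ((Filter.frequently_atTop.2 h).and_eventually (hfin.eventually_all.2 hrare)).exists
  exact h' _ hi rfl

theorem mem_lang_of_branch [Finite Q] {β : ℕ → ℕ} (hβ : M.IsBranch w β)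
    (hleft : ∀ n, ∃ i ≥ n, β i % 2 = 0) : w ∈ M.Lang := by
  obtain ⟨ρ, hρ⟩ := exists_seq_of_forall_exists_pred (fun i => M.node w i (β i))
    (fun i => Set.toFinite _) (fun i => (hβ i).1) (fun i p q => q ∈ M.trans p (w i)) (by
      rintro i q ⟨hq, hk⟩
      obtain ⟨p, hp, hpq, h⟩ := exists_parent hq
      exact ⟨p, ⟨hp, by rw [h, hk, (hβ i).2]⟩, hpq⟩)
  have hrun : M.IsRun w ρ := ⟨(hρ 0).1.1, fun i => (hρ i).2⟩
  refine ⟨ρ, hrun, accepting_of_frequently_mem (Set.toFinite M.acc) subset_rfl fun n => ?_⟩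
  obtain ⟨i, hi, he⟩ := hleft (n + 1)
  obtain ⟨j, rfl⟩ : ∃ j, i = j + 1 := ⟨i - 1, by omega⟩
  exact ⟨j + 1, by omega, key_succ_mod.1 (by rwa [(hρ (j + 1)).1.2])⟩

theorem IsRun.mem_reach {ρ : ℕ → Q} (hρ : M.IsRun w ρ) (i : ℕ) : ρ i ∈ M.reach w i := by
  induction i with
  | zero => exact hρ.1
  | succ i ih => exact mem_reach_succ.2 ⟨_, ih, hρ.2 i⟩

theorem exists_eventually_eq_of_antitone {f : ℕ → ℕ} (hf : Antitone f) :
    ∃ b, ∀ᶠ i in Filter.atTop, f i = b := by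
  obtain ⟨n, hn⟩ := Nat.sInf_mem (Set.range_nonempty f)
  refine ⟨f n, Filter.eventually_atTop.2 ⟨n, fun i hi => le_antisymm (hf hi) ?_⟩⟩
  rw [hn]
  exact Nat.sInf_le ⟨i, rfl⟩

theorem exists_branch_of_mem_lang (hw : w ∈ M.Lang) :
    ∃ β, M.IsBranch w β ∧ ∀ n, ∃ i ≥ n, β i % 2 = 0 := by
  obtain ⟨ρ, hρ, q₀, hq₀, hinf⟩ := hw
  set κ : ℕ → ℕ := fun i => M.key w i (ρ i)
  have hstep : ∀ i, κ (i + 1) / 2 ≤ κ i := fun i => key_succ_div_le (hρ.mem_reach i) (hρ.2 i)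
  have hanti : ∀ m, Antitone fun k => κ (m + k) / 2 ^ k := by
    intro m
    refine antitone_nat_of_succ_le fun k => ?_
    rw [pow_succ', ← Nat.div_div_eq_div_mul]
    exact Nat.div_le_div_right (hstep (m + k))
  choose β hβ using fun m => exists_eventually_eq_of_antitone (hanti m)
  have hβκ : ∀ m, β m ≤ κ m := by
    intro m
    obtain ⟨k, hk⟩ := (hβ m).exists
    have := hanti m (Nat.zero_le k)
    simp only [pow_zero, Nat.div_one, add_zero] at this
    exact hk ▸ this
  have hbranch : M.IsBranch w β := by
    intro m
    constructor
    · obtain ⟨k, hk⟩ := (hβ m).exists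
      rw [← hk]
      exact node_nonempty_div_pow ⟨ρ (m + k), hρ.mem_reach _, rfl⟩
    · obtain ⟨k, hk, hk'⟩ := (((Filter.tendsto_add_atTop_nat 1).eventually (hβ m)).and
        (hβ (m + 1))).exists
      rw [← hk, ← hk', Nat.div_div_eq_div_mul, pow_succ, Nat.add_right_comm m 1 k, add_assoc m k 1]
  refine ⟨β, hbranch, ?_⟩
  by_contra! hodd
  obtain ⟨m, hm⟩ := hodd
  have hmax : ∀ k, β (m + k) + 1 = 2 ^ k * (β m + 1) := by
    intro k
    induction k with
    | zero => simp
    | succ k ih =>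
      have h1 := (hbranch (m + k)).2
      have h2 := hm (m + k + 1) (by omega)
      rw [pow_succ', mul_assoc, ← ih, ← add_assoc m k 1]
      omega
  obtain ⟨K, hK⟩ := Filter.eventually_atTop.1 (hβ m)
  obtain ⟨i, hi, hiq⟩ := hinf (m + K + 1)
  obtain ⟨k, rfl⟩ : ∃ k, i = m + k + 1 := ⟨i - m - 1, by omega⟩
  have hlt : κ (m + (k + 1)) < 2 ^ (k + 1) * (β m + 1) :=
    Nat.lt_mul_of_div_lt (by rw [hK (k + 1) (by omega)]; omega) (by positivity) |>.trans_eq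
      (mul_comm _ _)
  rw [← hmax] at hlt
  have heq : β (m + (k + 1)) = κ (m + (k + 1)) := le_antisymm (hβκ _) (by omega)
  refine hm (m + k + 1) (by omega) ?_
  rw [add_assoc, heq]
  exact key_succ_mod.2 (hiq.symm ▸ hq₀)

theorem IsBranch.eventually_ne {β γ : ℕ → ℕ} (hβ : M.IsBranch w β) (hγ : M.IsBranch w γ)
    (h : β ≠ γ) : ∀ᶠ i in Filter.atTop, β i ≠ γ i := by
  obtain ⟨n, hn⟩ := Function.ne_iff.1 h
  refine Filter.eventually_atTop.2 ⟨n, fun i hi => ?_⟩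
  induction i, hi using Nat.le_induction with
  | base => exact hn
  | succ i _ ih =>
    intro h
    exact ih (by rw [(hβ i).2, (hγ i).2, h])

theorem finite_branches [Finite Q] : {β | M.IsBranch w β}.Finite := by
  have := Fintype.ofFinite Q
  by_contra hinf
  obtain ⟨T, hT, hcard⟩ := Set.Infinite.exists_subset_card_eq hinf (Fintype.card Q + 1)
  have hsep : ∀ᶠ i in Filter.atTop, ∀ β ∈ T, ∀ γ ∈ T, β ≠ γ → β i ≠ γ i := by
    refine (Filter.eventually_all_finset T).2 fun β hβ =>
      (Filter.eventually_all_finset T).2 fun γ hγ => ?_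
    by_cases h : β = γ
    · simp [h]
    · simpa [h] using (hT hβ).eventually_ne (hT hγ) h
  obtain ⟨i, hi⟩ := hsep.exists
  have hle : T.card ≤ (Finset.univ.image (M.key w i)).card := by
    refine Finset.card_le_card_of_injOn (fun β => β i) ?_ ?_
    · intro β hβ
      obtain ⟨q, -, hq⟩ := (hT hβ i).1
      simpa using ⟨q, hq⟩
    · intro β hβ γ hγ h
      by_contra hne
      exact hi β hβ γ hγ hne h
  have := hle.trans Finset.card_image_le
  rw [hcard, Finset.card_univ] at this
  omega

/-- A rejected word has a level after which infinite branches contain no left children. -/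
theorem exists_cutoff [Finite Q] (hw : w ∉ M.Lang) :
    ∃ N, ∀ β, M.IsBranch w β → ∀ i ≥ N, β i % 2 = 1 := by
  have h : ∀ β ∈ {β | M.IsBranch w β}, ∀ᶠ i in Filter.atTop, β i % 2 = 1 := by
    intro β hβ
    by_contra h
    rw [Filter.not_eventually, Filter.frequently_atTop] at h
    exact hw (mem_lang_of_branch hβ fun n => by simpa using h n)
  obtain ⟨N, hN⟩ := Filter.eventually_atTop.1 (finite_branches.eventually_all.2 h)
  exact ⟨N, fun β hβ i hi => hN i hi β hβ⟩

variable (M w) in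
/-- The undecorated slice reached after `i` letters. -/
noncomputable def slice : ℕ → List (Set Q)
  | 0 => [{M.init}]
  | i + 1 => duSucc M.trans M.acc (slice i) (w i)

variable (M w) in
/-- The unmerged decorated slices obtained by leaving the undecorated slices on level `N`, where
all nodes count as decorated `1`. -/
noncomputable def decSlice (N : ℕ) : ℕ → DSlice Q
  | 0 => (slice M w N).map fun S => (S, Dec.one)
  | j + 1 => ddSucc M.trans M.acc (decSlice N j) (w (N + j))

/-- The decoration of the node at position `k`, when `c` decorates the previous level. -/
def childDec (r : Bool) (c : ℕ → Dec) (k : ℕ) : Dec :=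
  if k % 2 = 0 then (decPair r (c (k / 2))).1 else (decPair r (c (k / 2))).2

variable (M w) in
/-- The decorations of the slices `decSlice`, as a function of the position of the node. -/
noncomputable def nodeDec (N : ℕ) : ℕ → ℕ → Dec
  | 0 => fun _ => Dec.one
  | j + 1 => childDec (isResetB (decSlice M w N j)) (nodeDec N j)

variable (M w) in
/-- The slice `s` lists the nodes of level `i` of the reduced split tree from left to right,
decorated according to `c`. -/
def Represents (i : ℕ) (s : DSlice Q) (c : ℕ → Dec) : Prop :=
  ∃ ks : List ℕ, ks.Pairwise (· < ·) ∧ (∀ k, k ∈ ks ↔ (M.node w i k).Nonempty) ∧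
    s = ks.map fun k => (M.node w i k, c k)

theorem mem_succ_diff_iff {i k : ℕ} {ks : List ℕ} {seen : Set Q}
    (hs : (k :: ks).Pairwise (· < ·))
    (hlow : ∀ p ∈ M.reach w i, M.key w i p ∉ k :: ks → M.key w i p < k)
    (hseen : ∀ q, q ∈ seen ↔ ∃ p ∈ M.reach w i, q ∈ M.trans p (w i) ∧ M.key w i p ∉ k :: ks)
    (q : Q) : q ∈ (⋃ p ∈ M.node w i k, M.trans p (w i)) \ seen ↔
      q ∈ M.reach w (i + 1) ∧ M.key w (i + 1) q / 2 = k := by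
  simp only [Set.mem_sdiff, Set.mem_iUnion, exists_prop]
  constructor
  · rintro ⟨⟨p, ⟨hp, hk⟩, hpq⟩, hq⟩
    have hr : q ∈ M.reach w (i + 1) := mem_reach_succ.2 ⟨p, hp, hpq⟩
    refine ⟨hr, le_antisymm (hk ▸ key_succ_div_le hp hpq) ?_⟩
    obtain ⟨p', hp', hpq', hk'⟩ := exists_parent hr
    rw [← hk']
    by_contra hlt
    refine hq ((hseen q).2 ⟨p', hp', hpq', fun hmem => hlt ?_⟩)
    rcases List.mem_cons.1 hmem with h | h
    · exact h.ge
    · exact ((List.pairwise_cons.1 hs).1 _ h).le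
  · rintro ⟨hr, hk⟩
    obtain ⟨p, hp, hpq, hkp⟩ := exists_parent hr
    refine ⟨⟨p, ⟨hp, hkp.trans hk⟩, hpq⟩, fun hq => ?_⟩
    obtain ⟨p', hp', hpq', hk'⟩ := (hseen q).1 hq
    have h1 := hlow p' hp' hk'
    have h2 := key_succ_div_le hp' hpq'
    omega

theorem ddAux_map_node {i : ℕ} (r : Bool) (c : ℕ → Dec) (ks : List ℕ) (seen : Set Q)
    (hs : ks.Pairwise (· < ·))
    (hlow : ∀ p ∈ M.reach w i, M.key w i p ∉ ks → ∀ k ∈ ks, M.key w i p < k)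
    (hseen : ∀ q, q ∈ seen ↔ ∃ p ∈ M.reach w i, q ∈ M.trans p (w i) ∧ M.key w i p ∉ ks) :
    ddAux M.trans M.acc (w i) r (ks.map fun k => (M.node w i k, c k)) seen =
      (ks.flatMap fun k => [2 * k, 2 * k + 1]).map
        fun k => (M.node w (i + 1) k, childDec r c k) := by
  induction ks generalizing seen with
  | nil => rfl
  | cons k ks ih =>
    have hmem := mem_succ_diff_iff hs (fun p hp h => hlow p hp h k List.mem_cons_self) hseen
    simp only [Set.mem_sdiff] at hmem
    have hleft : ((⋃ p ∈ M.node w i k, M.trans p (w i)) ∩ M.acc) \ seen =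
        M.node w (i + 1) (2 * k) := by
      ext q
      have h := hmem q
      have hacc := key_succ_mod (M := M) (w := w) (i := i) (q := q)
      have hk : M.key w (i + 1) q = 2 * k ↔
          M.key w (i + 1) q / 2 = k ∧ M.key w (i + 1) q % 2 = 0 := by omega
      simp only [node, Set.mem_sdiff, Set.mem_inter_iff, Set.mem_ofPred_eq] at h ⊢
      rw [hk, hacc]
      tauto
    have hright : ((⋃ p ∈ M.node w i k, M.trans p (w i)) \ M.acc) \ seen =
        M.node w (i + 1) (2 * k + 1) := by
      ext q
      have h := hmem q
      have hacc := key_succ_mod (M := M) (w := w) (i := i) (q := q)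
      have hk : M.key w (i + 1) q = 2 * k + 1 ↔
          M.key w (i + 1) q / 2 = k ∧ ¬ M.key w (i + 1) q % 2 = 0 := by omega
      simp only [node, Set.mem_sdiff, Set.mem_ofPred_eq] at h ⊢
      rw [hk, hacc]
      tauto
    obtain ⟨hk, hks⟩ := List.pairwise_cons.1 hs
    simp only [List.map_cons, ddAux, List.flatMap_cons, List.cons_append, List.nil_append]
    rw [ih _ hks]
    · rw [hleft, hright]
      simp [childDec, Nat.mul_add_div]
    · intro p hp hpk l hl
      by_cases h : M.key w i p = k
      · exact h ▸ hk l hl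
      · exact hlow p hp (by simp [h, hpk]) l (List.mem_cons_of_mem _ hl)
    · intro q
      have hknot : k ∉ ks := fun h => lt_irrefl _ (hk k h)
      have hsplit : (∃ p ∈ M.reach w i, q ∈ M.trans p (w i) ∧ M.key w i p ∉ ks) ↔
          q ∈ seen ∨ q ∈ ⋃ p ∈ M.node w i k, M.trans p (w i) := by
        rw [hseen]
        simp only [Set.mem_iUnion, exists_prop, node, Set.mem_ofPred_eq, List.mem_cons, not_or]
        constructor
        · rintro ⟨p, hp, hpq, h⟩
          by_cases hpk : M.key w i p = k
          · exact Or.inr ⟨p, ⟨hp, hpk⟩, hpq⟩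
          · exact Or.inl ⟨p, hp, hpq, hpk, h⟩
        · rintro (⟨p, hp, hpq, -, h⟩ | ⟨p, ⟨hp, hpk⟩, hpq⟩)
          · exact ⟨p, hp, hpq, h⟩
          · exact ⟨p, hp, hpq, hpk ▸ hknot⟩
      rw [hsplit]
      simp only [Set.mem_union, Set.mem_sdiff, Set.mem_inter_iff]
      tauto

theorem Represents.ddSucc {i : ℕ} {s : DSlice Q} {c : ℕ → Dec} (h : M.Represents w i s c) :
    M.Represents w (i + 1) (ddSucc M.trans M.acc s (w i)) (childDec (isResetB s) c) := by
  classical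
  obtain ⟨ks, hs, hmem, hsk⟩ := h
  have hin : ∀ p ∈ M.reach w i, M.key w i p ∈ ks := fun p hp => (hmem _).2 ⟨p, hp, rfl⟩
  refine ⟨(ks.flatMap fun k => [2 * k, 2 * k + 1]).filter
    fun k => decide (M.node w (i + 1) k).Nonempty, ?_, ?_, ?_⟩
  · refine List.Pairwise.filter _ (List.pairwise_flatMap.2 ⟨by simp, ?_⟩)
    refine hs.imp fun {a b} hab => ?_
    simp only [List.mem_cons, List.not_mem_nil, or_false]
    omega
  · intro k
    simp only [List.mem_filter, List.mem_flatMap, List.mem_cons, List.not_mem_nil, or_false,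
      decide_eq_true_eq, and_iff_right_iff_imp]
    intro hk
    exact ⟨k / 2, (hmem _).2 (node_nonempty_div hk), by omega⟩
  · rw [_root_.ddSucc]
    nth_rewrite 2 [hsk]
    rw [ddAux_map_node _ c ks ∅ hs (fun p hp h => absurd (hin p hp) h)
      (fun q => by simpa using fun p hp _ => hin p hp), List.filter_map]
    congr 1

theorem Represents.map_fst {i : ℕ} {s : DSlice Q} {c : ℕ → Dec} (h : M.Represents w i s c) :
    M.Represents w i ((s.map Prod.fst).map fun S => (S, Dec.one)) fun _ => Dec.one := by
  obtain ⟨ks, hs, hmem, rfl⟩ := h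
  exact ⟨ks, hs, hmem, by simp⟩

theorem represents_slice (i : ℕ) :
    M.Represents w i ((M.slice w i).map fun S => (S, Dec.one)) fun _ => Dec.one := by
  induction i with
  | zero =>
    refine ⟨[0], by simp, fun k => ?_, ?_⟩
    · simp [node, reach, key, Set.Nonempty, eq_comm]
    · simp [slice, node, reach, key]
  | succ i ih =>
    have h := ih.ddSucc.map_fst
    rwa [map_fst_ddSucc, List.map_map, Function.comp_def, List.map_id'] at h

theorem represents_decSlice (N j : ℕ) :
    M.Represents w (N + j) (M.decSlice w N j) (M.nodeDec w N j) := by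
  induction j with
  | zero => exact represents_slice N
  | succ j ih => exact ih.ddSucc

theorem Represents.forall_dec_ne_iff {i : ℕ} {s : DSlice Q} {c : ℕ → Dec}
    (h : M.Represents w i s c) (d : Dec) :
    (∀ x ∈ s, x.2 ≠ d) ↔ ∀ k, (M.node w i k).Nonempty → c k ≠ d := by
  obtain ⟨ks, -, hmem, rfl⟩ := h
  simp [← hmem]

theorem Represents.eq_nil_iff {i : ℕ} {s : DSlice Q} {c : ℕ → Dec}
    (h : M.Represents w i s c) : s = [] ↔ M.reach w i = ∅ := by
  obtain ⟨ks, -, hmem, rfl⟩ := h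
  rw [List.map_eq_nil_iff, List.eq_nil_iff_forall_not_mem, Set.eq_empty_iff_forall_notMem]
  simp only [hmem]
  exact ⟨fun h q hq => h _ ⟨q, hq, rfl⟩, fun h k ⟨q, hq, _⟩ => h q hq⟩

theorem Represents.length_le [Fintype Q] {i : ℕ} {s : DSlice Q} {c : ℕ → Dec}
    (h : M.Represents w i s c) : s.length ≤ Fintype.card Q := by
  obtain ⟨ks, hs, hmem, rfl⟩ := h
  rw [List.length_map, ← List.toFinset_card_of_nodup (hs.imp fun h => h.ne)]
  refine le_trans (Finset.card_le_card (t := Finset.univ.image (M.key w i)) fun k hk => ?_)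
    Finset.card_image_le
  obtain ⟨q, -, hq⟩ := (hmem k).1 (List.mem_toFinset.1 hk)
  exact Finset.mem_image.2 ⟨q, Finset.mem_univ q, hq⟩

theorem slice_eq_nil_iff (i : ℕ) : M.slice w i = [] ↔ M.reach w i = ∅ := by
  rw [← (represents_slice i).eq_nil_iff, List.map_eq_nil_iff]

theorem decSlice_eq_nil_iff (N j : ℕ) : M.decSlice w N j = [] ↔ M.reach w (N + j) = ∅ :=
  (represents_decSlice N j).eq_nil_iff

theorem isResetB_decSlice (N j : ℕ) : isResetB (M.decSlice w N j) = true ↔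
    ∀ k, (M.node w (N + j) k).Nonempty → M.nodeDec w N j k ≠ Dec.zero := by
  rw [isResetB_iff, (represents_decSlice N j).forall_dec_ne_iff]

theorem doomed_decSlice (N j : ℕ) : Doomed (M.decSlice w N j) ↔
    ∀ k, (M.node w (N + j) k).Nonempty → M.nodeDec w N j k ≠ Dec.one := by
  rw [Doomed, (represents_decSlice N j).forall_dec_ne_iff]

theorem nodeDec_eq_one_of_odd {β : ℕ → ℕ} (hβ : M.IsBranch w β) {N : ℕ}
    (hodd : ∀ i ≥ N, β i % 2 = 1) (j : ℕ) : M.nodeDec w N j (β (N + j)) = Dec.one := by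
  induction j with
  | zero => rfl
  | succ j ih =>
    have h1 := hodd (N + j + 1) (by omega)
    have h2 := (hβ (N + j)).2
    rw [nodeDec, childDec, ← add_assoc, ← h2, ih, h1]
    cases isResetB (M.decSlice w N j) <;> simp [decPair]

theorem childDec_false_eq_zero_iff (c : ℕ → Dec) (k : ℕ) :
    childDec false c k = Dec.zero ↔ c (k / 2) = Dec.zero := by
  unfold childDec
  cases c (k / 2) <;> simp only [decPair, Bool.false_eq_true, if_false] <;> split_ifs <;> simp

theorem childDec_ne_one {c : ℕ → Dec} {k : ℕ} (r : Bool) (h : c (k / 2) ≠ Dec.one) :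
    childDec r c k ≠ Dec.one := by
  obtain ⟨e, he, hp⟩ := exists_decPair_eq h r
  simp [childDec, hp, he]

theorem childDec_ne_one_of_even (c : ℕ → Dec) {k : ℕ} (r : Bool) (h : k % 2 = 0) :
    childDec r c k ≠ Dec.one := by
  unfold childDec
  cases r <;> cases c (k / 2) <;> simp [decPair, h]

theorem childDec_true_eq_zero {c : ℕ → Dec} {k : ℕ} (h : c (k / 2) ≠ Dec.one) :
    childDec true c k = Dec.zero := by
  unfold childDec
  cases hc : c (k / 2) <;> simp_all [decPair]

theorem exists_decSlice_of_notMem_lang [Finite Q] (hw : w ∉ M.Lang)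
    (hne : ∀ i, (M.reach w i).Nonempty) : ∃ N, (∀ j, ¬ Doomed (M.decSlice w N j)) ∧
      ∀ n, ∃ j ≥ n, isResetB (M.decSlice w N j) = true := by
  obtain ⟨N, hN⟩ := exists_cutoff hw
  refine ⟨N, fun j => ?_, ?_⟩
  · obtain ⟨β, hβ, -⟩ := exists_branch_of_levels (M := M) (w := w)
      (fun i => {k | (M.node w i k).Nonempty})
      (fun i => (hne i).elim fun q hq => ⟨_, q, hq, rfl⟩) (fun i k hk => hk)
      (fun i k hk => node_nonempty_div hk)
    rw [doomed_decSlice]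
    exact fun h => h _ (hβ (N + j)).1 (nodeDec_eq_one_of_odd hβ (hN β hβ) j)
  · by_contra! h
    obtain ⟨J, hJ⟩ := h
    have hzero : ∀ j ≥ J, ∃ k, (M.node w (N + j) k).Nonempty ∧
        M.nodeDec w N j k = Dec.zero := by
      intro j hj
      have := hJ j hj
      rw [Ne, isResetB_decSlice] at this
      simpa using this
    let S : ℕ → Set ℕ := fun i => {k | (M.node w i k).Nonempty ∧
      ∀ j ≥ J, i = N + j → M.nodeDec w N j k = Dec.zero}
    have hSne : ∀ i, (S i).Nonempty := by
      intro i
      by_cases hi : N + J ≤ i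
      · obtain ⟨j, rfl⟩ := Nat.exists_eq_add_of_le (le_trans (Nat.le_add_right N J) hi)
        obtain ⟨k, hk, hk0⟩ := hzero j (by omega)
        refine ⟨k, hk, fun j' _ h => ?_⟩
        obtain rfl : j = j' := by omega
        exact hk0
      · obtain ⟨q, hq⟩ := hne i
        exact ⟨_, ⟨q, hq, rfl⟩, fun j hj h => absurd h (by omega)⟩
    have hSdiv : ∀ i, ∀ k ∈ S (i + 1), k / 2 ∈ S i := by
      rintro i k ⟨hk, hk0⟩
      refine ⟨node_nonempty_div hk, ?_⟩
      rintro j hj rfl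
      have h1 := hk0 (j + 1) (by omega) rfl
      rwa [nodeDec, Bool.eq_false_iff.2 (hJ j hj), childDec_false_eq_zero_iff] at h1
    obtain ⟨β, hβ, hβ0⟩ := exists_branch_of_levels S hSne (fun i k hk => hk.1) hSdiv
    have h0 := (hβ0 (N + J)).2 J le_rfl rfl
    rw [nodeDec_eq_one_of_odd hβ (hN β hβ) J] at h0
    cases h0

theorem notMem_lang_of_resets {N : ℕ}
    (hreset : ∀ n, ∃ j ≥ n, isResetB (M.decSlice w N j) = true) : w ∉ M.Lang := by
  intro hw
  obtain ⟨β, hβ, hleft⟩ := exists_branch_of_mem_lang hw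
  obtain ⟨i, hi, heven⟩ := hleft (N + 1)
  obtain ⟨a, rfl⟩ : ∃ a, i = N + a + 1 := ⟨i - N - 1, by omega⟩
  have hsucc : ∀ j, M.nodeDec w N (j + 1) (β (N + (j + 1))) =
      childDec (isResetB (M.decSlice w N j)) (M.nodeDec w N j) (β (N + j + 1)) := fun j => rfl
  have hne : ∀ j ≥ a + 1, M.nodeDec w N j (β (N + j)) ≠ Dec.one := by
    intro j hj
    induction j, hj using Nat.le_induction with
    | base => exact childDec_ne_one_of_even _ _ heven
    | succ j _ ih =>
      rw [hsucc]
      exact childDec_ne_one _ (by rwa [← (hβ (N + j)).2])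
  obtain ⟨b, hb, hbr⟩ := hreset (a + 1)
  have hzero : ∀ j ≥ b + 1, M.nodeDec w N j (β (N + j)) = Dec.zero := by
    intro j hj
    induction j, hj using Nat.le_induction with
    | base =>
      rw [hsucc, hbr]
      exact childDec_true_eq_zero (by rw [← (hβ (N + b)).2]; exact hne b hb)
    | succ j _ ih =>
      have hr : isResetB (M.decSlice w N j) = false := by
        rw [Bool.eq_false_iff, Ne, isResetB_decSlice]
        exact fun h => h _ (hβ (N + j)).1 ih
      rw [hsucc, hr, childDec_false_eq_zero_iff, ← (hβ (N + j)).2, ih]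
  obtain ⟨c, hc, hcr⟩ := hreset (b + 1)
  exact (isResetB_decSlice N c).1 hcr _ (hβ (N + c)).1 (hzero c hc)

theorem mem_sliceComplement_trans_inl {u : List (Set Q)} {a : A}
    {t : List (Set Q) ⊕ DSlice Q} : t ∈ (sliceComplement M).trans (Sum.inl u) a ↔
      (duSucc M.trans M.acc u a = [] ∧ t = Sum.inr []) ∨
      (duSucc M.trans M.acc u a ≠ [] ∧ t = Sum.inl (duSucc M.trans M.acc u a)) ∨
      (¬ Doomed (dgSucc M.trans M.acc u a) ∧
        t = Sum.inr (dmerge (dgSucc M.trans M.acc u a))) := by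
  simp only [sliceComplement, Set.mem_union, Set.mem_ofPred_eq, ← or_assoc]
  refine or_congr_left ?_
  cases duSucc M.trans M.acc u a <;> simp

theorem mem_sliceComplement_trans_inr {d : DSlice Q} (hd : d ≠ []) {a : A}
    {t : List (Set Q) ⊕ DSlice Q} : t ∈ (sliceComplement M).trans (Sum.inr d) a ↔
      ¬ Doomed (ddSucc M.trans M.acc d a) ∧
        t = Sum.inr (dmerge (ddSucc M.trans M.acc d a)) := by
  cases d with
  | nil => exact absurd rfl hd
  | cons x d => rfl

theorem decSlice_one (N : ℕ) :
    M.decSlice w N 1 = dgSucc M.trans M.acc (M.slice w N) (w N) :=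
  (dgSucc_eq_ddSucc _ _ _ _).symm

theorem notMem_lang_of_mem_sliceComplement (hw : w ∈ (sliceComplement M).Lang) :
    w ∉ M.Lang := by
  intro hL
  obtain ⟨σ, ⟨hσ0, hσ⟩, q, ⟨d, rfl, hd⟩, hinf⟩ := hw
  obtain ⟨ρ, hρ, -⟩ := id hL
  have hne : ∀ i, M.reach w i ≠ ∅ := fun i => Set.nonempty_iff_ne_empty.1 ⟨_, hρ.mem_reach i⟩
  have hstep : ∀ N j, σ (N + j) = Sum.inr (dmerge (M.decSlice w N j)) →
      σ (N + (j + 1)) = Sum.inr (dmerge (M.decSlice w N (j + 1))) := by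
    intro N j h
    have ht := hσ (N + j)
    rw [h, mem_sliceComplement_trans_inr, dmerge_ddSucc_dmerge] at ht
    · exact ht.2
    · rw [Ne, dmerge_eq_nil_iff, decSlice_eq_nil_iff]
      exact hne _
  have hform : ∀ i, σ i = Sum.inl (M.slice w i) ∨
      ∃ N j, i = N + j ∧ σ (N + j) = Sum.inr (dmerge (M.decSlice w N j)) := by
    intro i
    induction i with
    | zero => exact Or.inl hσ0
    | succ i ih =>
      rcases ih with h | ⟨N, j, rfl, h⟩
      · have ht := hσ i
        rw [h, mem_sliceComplement_trans_inl] at ht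
        rcases ht with ⟨ht, -⟩ | ⟨-, ht⟩ | ⟨-, ht⟩
        · exact absurd ((slice_eq_nil_iff (i + 1)).1 ht) (hne _)
        · exact Or.inl ht
        · rw [← decSlice_one] at ht
          exact Or.inr ⟨i, 1, rfl, ht⟩
      · exact Or.inr ⟨N, j + 1, rfl, hstep N j h⟩
  obtain ⟨i, -, hi⟩ := hinf 0
  rcases hform i with h | ⟨N, j, rfl, h⟩
  · rw [h] at hi
    cases hi
  · have hall : ∀ k ≥ j, σ (N + k) = Sum.inr (dmerge (M.decSlice w N k)) := by
      intro k hk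
      induction k, hk using Nat.le_induction with
      | base => exact h
      | succ k _ ih => exact hstep N k ih
    refine notMem_lang_of_resets (N := N) (fun n => ?_) hL
    obtain ⟨i, hi, hid⟩ := hinf (N + j + n)
    obtain ⟨k, rfl⟩ := Nat.exists_eq_add_of_le (show N ≤ i by omega)
    refine ⟨k, by omega, ?_⟩
    rw [hall k (by omega)] at hid
    rw [← isResetB_dmerge, isResetB_iff, Sum.inr.inj hid]
    exact hd

theorem mem_sliceComplement_of_notMem_lang [Fintype Q] (hw : w ∉ M.Lang) :
    w ∈ (sliceComplement M).Lang := by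
  by_cases hne : ∀ i, (M.reach w i).Nonempty
  · obtain ⟨N, hlive, hreset⟩ := exists_decSlice_of_notMem_lang hw hne
    have hnil : ∀ i, M.slice w i ≠ [] := fun i =>
      (slice_eq_nil_iff i).not.2 (hne i).ne_empty
    let σ : ℕ → List (Set Q) ⊕ DSlice Q := fun i =>
      if i ≤ N then Sum.inl (M.slice w i) else Sum.inr (dmerge (M.decSlice w N (i - N)))
    refine ⟨σ, ⟨by simp [σ, slice, sliceComplement], fun i => ?_⟩, ?_⟩
    · rcases lt_trichotomy i N with hi | rfl | hi
      · have h1 : σ i = Sum.inl (M.slice w i) := if_pos hi.le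
        have h2 : σ (i + 1) = Sum.inl (M.slice w (i + 1)) := if_pos hi
        rw [h1, h2, mem_sliceComplement_trans_inl]
        exact Or.inr (Or.inl ⟨hnil (i + 1), rfl⟩)
      · have h1 : σ i = Sum.inl (M.slice w i) := if_pos le_rfl
        have h2 : σ (i + 1) = Sum.inr (dmerge (M.decSlice w i 1)) := by simp [σ]
        rw [h1, h2, mem_sliceComplement_trans_inl, ← decSlice_one]
        exact Or.inr (Or.inr ⟨hlive 1, rfl⟩)
      · obtain ⟨j, rfl⟩ := Nat.exists_eq_add_of_le hi.le
        have h1 : σ (N + j) = Sum.inr (dmerge (M.decSlice w N j)) := by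
          simp [σ, show j ≠ 0 by omega]
        have h2 : σ (N + j + 1) = Sum.inr (dmerge (M.decSlice w N (j + 1))) := by
          simp [σ, add_assoc]
        rw [h1, h2, mem_sliceComplement_trans_inr, doomed_ddSucc_dmerge_iff,
          dmerge_ddSucc_dmerge]
        · exact ⟨hlive (j + 1), rfl⟩
        · rw [Ne, dmerge_eq_nil_iff, decSlice_eq_nil_iff]
          exact (hne _).ne_empty
    · refine accepting_of_frequently_mem
        (S := Sum.inr '' {d : DSlice Q | d.length ≤ Fintype.card Q ∧ ∀ x ∈ d, x.2 ≠ Dec.zero})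
        (((List.finite_length_le _ _).subset fun d hd => hd.1).image _) ?_ fun n => ?_
      · rintro _ ⟨d, hd, rfl⟩
        exact ⟨d, rfl, hd.2⟩
      · obtain ⟨j, hj, hr⟩ := hreset (n + 1)
        refine ⟨N + j, by omega, dmerge (M.decSlice w N j), ⟨?_, ?_⟩, ?_⟩
        · exact (length_dmerge_le _).trans (represents_decSlice N j).length_le
        · rwa [← isResetB_iff, isResetB_dmerge]
        · simp [σ, show j ≠ 0 by omega]
  · push Not at hne
    obtain ⟨n, hn⟩ := hne
    have hnil : ∀ i, M.slice w i = [] → M.slice w (i + 1) = [] := by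
      intro i hi
      rw [slice, hi]
      rfl
    have hdead : ∀ i ≥ n, M.slice w i = [] := by
      intro i hi
      induction i, hi using Nat.le_induction with
      | base => exact (slice_eq_nil_iff n).2 hn
      | succ i _ ih => exact hnil i ih
    classical
    refine ⟨fun i => if M.slice w i = [] then Sum.inr [] else Sum.inl (M.slice w i),
      ⟨by simp [slice, sliceComplement], fun i => ?_⟩, Sum.inr [], ⟨[], rfl, by simp⟩,
      fun m => ⟨m + n, by omega, if_pos (hdead _ (by omega))⟩⟩
    by_cases hi : M.slice w i = []
    · simp only [hi, hnil i hi, if_true]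
      rfl
    · simp only [hi, if_false]
      rw [mem_sliceComplement_trans_inl]
      by_cases hi' : M.slice w (i + 1) = []
      · exact Or.inl ⟨hi', if_pos hi'⟩
      · exact Or.inr (Or.inl ⟨hi', if_neg hi'⟩)

end NBW

/-- The improved slice-based construction complements the NBW. -/
theorem stmt14 {A Q : Type*} [Fintype Q] (M : NBW A Q) :
    (sliceComplement M).Lang = {w | w ∉ M.Lang} := by
  ext w
  exact ⟨NBW.notMem_lang_of_mem_sliceComplement, NBW.mem_sliceComplement_of_notMem_lang⟩
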